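/- Let Q be a finite quiver with vertex set I having at most one directed path (including paths of length 0) between any ordered pair of vertices. Let a : I → ℕ, set b_k := a_k − Σ_{arrows k → j of Q} a_j, and fix i ∈ I with a_i > 0. Let out(i) denote the set of vertices j with a_j > 0 admitting a directed path from i to j all of whose vertices l satisfy a_l > 0 (so i ∈ out(i)). Set e_k := b_k − δ_{k,i} + #{arrows k → j of Q with j ∈ out(i)} − #{arrows j → k of Q with j ∈ out(i)}. If a'' : I → ℤ satisfies a''_k = max(0, e_k + Σ_{arrows k → j of Q} a''_j) for every k ∈ I, then a''_k = a_k − 1 for every k ∈ out(i) and a''_k = a_k for every k ∉ out(i). -/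

import Mathlib

/-!
STATEMENT 9: the central weight computation in the proof of Proposition 6.10 of the
paper: 𝛚((X'', h'')) = β − dim P_i^β.
-/

open Finset

/-- The quiver has at most one directed path (including length-0 paths) between any
ordered pair of vertices. -/
def UniquePaths {I : Type*} (Arr : I → I → Prop) : Prop :=
  ∀ l₁ l₂ : List I, l₁.Chain' Arr → l₂.Chain' Arr → l₁ ≠ [] → l₂ ≠ [] →
    l₁.head? = l₂.head? → l₁.getLast? = l₂.getLast? → l₁ = l₂

/-- j ∈ out(i): a_j > 0 and there is a directed path from i to j all of whose
vertices l satisfy a_l > 0. -/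
def OutSupp {I : Type*} (Arr : I → I → Prop) (a : I → ℕ) (i j : I) : Prop :=
  0 < a j ∧ Relation.ReflTransGen (fun u v => 0 < a u ∧ 0 < a v ∧ Arr u v) i j

/-- A directed path, as given by `Relation.ReflTransGen`, is realised by a list of vertices. -/
theorem exists_isChain_of_reflTransGen {I : Type*} {r : I → I → Prop} {i j : I}
    (h : Relation.ReflTransGen r i j) :
    ∃ l : List I, l.IsChain r ∧ l.head? = some i ∧ l.getLast? = some j := by
  induction h with
  | refl => exact ⟨[i], by simp⟩
  | @tail b c _ hbc ih =>
    obtain ⟨l, hc, hh, hl⟩ := ih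
    refine ⟨l ++ [c], ?_, by simp [hh], by simp⟩
    rw [List.isChain_append]
    refine ⟨hc, by simp, ?_⟩
    intro x hx y hy
    simp_all

/-- Two arrows with the same target whose sources are reachable from `i` are equal. -/
theorem UniquePaths.source_eq {I : Type*} {Arr : I → I → Prop} (hU : UniquePaths Arr)
    {i j₁ j₂ k : I} (h₁ : Relation.ReflTransGen Arr i j₁) (h₂ : Relation.ReflTransGen Arr i j₂)
    (hk₁ : Arr j₁ k) (hk₂ : Arr j₂ k) : j₁ = j₂ := by
  obtain ⟨l₁, hc₁, hh₁, hl₁⟩ := exists_isChain_of_reflTransGen h₁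
  obtain ⟨l₂, hc₂, hh₂, hl₂⟩ := exists_isChain_of_reflTransGen h₂
  have key := hU (l₁ ++ [k]) (l₂ ++ [k])
    (List.isChain_append.2 ⟨hc₁, by simp, by simp_all⟩)
    (List.isChain_append.2 ⟨hc₂, by simp, by simp_all⟩)
    (by simp) (by simp) (by simp [hh₁, hh₂]) (by simp)
  have hl : l₁ = l₂ := List.append_cancel_right key
  subst hl
  simpa [hl₁] using hl₂

/-- A quiver with unique paths is acyclic. -/
theorem UniquePaths.not_arr_of_reflTransGen {I : Type*} {Arr : I → I → Prop}
    (hU : UniquePaths Arr) {i j : I} (h : Relation.ReflTransGen Arr i j) : ¬ Arr j i := by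
  intro hji
  obtain ⟨l, hc, hh, hl⟩ := exists_isChain_of_reflTransGen h
  have key := hU (l ++ [i]) [i] (List.isChain_append.2 ⟨hc, by simp, by simp_all⟩)
    (List.isChain_singleton i) (by simp) (by simp) (by simp [hh]) (by simp)
  have hl' : l = [] := by simpa using key
  rw [hl'] at hh
  cases hh

theorem UniquePaths.wellFounded {I : Type*} [Finite I] {Arr : I → I → Prop}
    (hU : UniquePaths Arr) : WellFounded (fun x y => Arr y x) := by
  have : Std.Irrefl (Relation.TransGen fun x y => Arr y x) := ⟨fun x hx => by
    obtain ⟨y, hy, hyx⟩ := (Relation.TransGen.tail'_iff).1 (Relation.transGen_swap.1 hx)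
    exact hU.not_arr_of_reflTransGen hy hyx⟩
  exact (Finite.wellFounded_of_trans_of_irrefl (Relation.TransGen fun x y => Arr y x)).mono
    fun _ _ h => Relation.TransGen.single h

theorem OutSupp.reflTransGen {I : Type*} {Arr : I → I → Prop} {a : I → ℕ} {i j : I}
    (h : OutSupp Arr a i j) : Relation.ReflTransGen Arr i j :=
  Relation.ReflTransGen.mono (fun _ _ h => h.2.2) _ _ h.2

open scoped Classical in
/-- For `k ∈ out(i)` exactly one of the following holds, exactly once: `k = i`, or an arrow
from `out(i)` ends at `k`. -/
theorem OutSupp.ite_add_card {I : Type*} [Fintype I] {Arr : I → I → Prop}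
    (hU : UniquePaths Arr) {a : I → ℕ} {i k : I} (h : OutSupp Arr a i k) :
    (if k = i then 1 else 0) +
      (univ.filter (fun j => Arr j k ∧ OutSupp Arr a i j)).card = 1 := by
  split_ifs with hki
  · subst hki
    simp only [Nat.add_eq_left, card_eq_zero, filter_eq_empty_iff]
    rintro j - ⟨hj, hout⟩
    exact hU.not_arr_of_reflTransGen hout.reflTransGen hj
  · obtain h' | ⟨j, hij, hj, -, hjk⟩ := Relation.ReflTransGen.cases_tail h.2
    · exact absurd h' hki
    rw [zero_add, card_eq_one]
    refine ⟨j, Finset.ext fun j' => ?_⟩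
    simp only [mem_filter, mem_univ, true_and, mem_singleton]
    constructor
    · rintro ⟨hj'k, hout⟩
      exact hU.source_eq hout.reflTransGen (OutSupp.reflTransGen ⟨hj, hij⟩) hj'k hjk
    · rintro rfl
      exact ⟨hjk, hj, hij⟩

open scoped Classical in
theorem stmt9 {I : Type*} [Fintype I] (Arr : I → I → Prop)
    (hU : UniquePaths Arr)
    (a : I → ℕ) (i : I) (hi : 0 < a i) (a'' : I → ℤ)
    (ha'' : ∀ k, a'' k =
      max 0 (((((a k : ℤ) - ∑ j ∈ univ.filter (fun j => Arr k j), (a j : ℤ))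
        - (if k = i then 1 else 0))
        + ((univ.filter (fun j => Arr k j ∧ OutSupp Arr a i j)).card : ℤ)
        - ((univ.filter (fun j => Arr j k ∧ OutSupp Arr a i j)).card : ℤ))
        + ∑ j ∈ univ.filter (fun j => Arr k j), a'' j)) :
    ∀ k, (OutSupp Arr a i k → a'' k = (a k : ℤ) - 1) ∧
      (¬ OutSupp Arr a i k → a'' k = (a k : ℤ)) := by
  have hsupp : ∀ k, a'' k = (a k : ℤ) - if OutSupp Arr a i k then 1 else 0 := by
    intro k
    induction k using hU.wellFounded.induction with
    | _ k ih =>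
    have hsum : ∑ j ∈ univ.filter (fun j => Arr k j), a'' j =
        ∑ j ∈ univ.filter (fun j => Arr k j), (a j : ℤ) -
          ((univ.filter (fun j => Arr k j ∧ OutSupp Arr a i j)).card : ℤ) := by
      rw [sum_congr rfl fun j hj => ih j (mem_filter.1 hj).2, sum_sub_distrib, sum_boole,
        filter_filter]
    rw [ha'' k, hsum]
    by_cases hk : OutSupp Arr a i k
    · have h1 := hk.ite_add_card hU
      have hpos := hk.1
      zify at h1
      rw [if_pos hk, max_eq_right] <;> linarith
    · have hki : k ≠ i := by
        rintro rfl
        exact hk ⟨hi, .refl⟩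
      rw [if_neg hk, if_neg hki]
      rcases Nat.eq_zero_or_pos (a k) with h0 | hpos
      · rw [h0, Nat.cast_zero, sub_zero, sub_zero, max_eq_left]
        linarith [Nat.cast_nonneg (α := ℤ)
          (univ.filter (fun j => Arr j k ∧ OutSupp Arr a i j)).card]
      · have hcard : (univ.filter (fun j => Arr j k ∧ OutSupp Arr a i j)).card = 0 := by
          rw [card_eq_zero, filter_eq_empty_iff]
          rintro j - ⟨hj, hout⟩
          exact hk ⟨hpos, hout.2.tail ⟨hout.1, hpos, hj⟩⟩
        rw [hcard, max_eq_right] <;> push_cast <;> linarith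
  intro k
  rw [hsupp k]
  exact ⟨fun h => by rw [if_pos h], fun h => by rw [if_neg h, sub_zero]⟩
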